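/- Parity criterion for contextuality (parity proofs): Let V be a finite type and e : Fin l → Finset V a hypergraph such that l is odd and every vertex has even multiplicity m(v). Then the hypergraph admits no exact-one assignment, i.e., it is non-binary (contextual). -/

import Mathlib

/-- Parity criterion for contextuality (parity proofs): if the number `l` of hyperedges is
odd and every vertex has even multiplicity, then the hypergraph admits no exact-one
assignment, i.e. it is non-binary (contextual). -/
theorem parity_proof_contextual {V : Type*} [Fintype V] [DecidableEq V] {l : ℕ}
    (e : Fin l → Finset V) (hl : Odd l)
    (hm : ∀ v : V, Even (Finset.univ.filter (fun j : Fin l => v ∈ e j)).card) :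
    ¬ ∃ f : V → Bool, ∀ j : Fin l, ((e j).filter (fun v => f v = true)).card = 1 := by
  rintro ⟨f, hf⟩
  have double_count : ∑ v with f v = true, (Finset.univ.filter (fun j : Fin l => v ∈ e j)).card
      = ∑ j : Fin l, ((e j).filter (fun v => f v = true)).card := by
    refine (Finset.sum_card_bipartiteAbove_eq_sum_card_bipartiteBelow
      (fun v j => v ∈ e j)).trans (Finset.sum_congr rfl fun j _ => congrArg _ ?_)
    ext v
    simp [Finset.bipartiteBelow, and_comm]
  have card_eq : ∑ v with f v = true, (Finset.univ.filter (fun j : Fin l => v ∈ e j)).card = l := by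
    simp [double_count, hf]
  exact Nat.not_even_iff_odd.mpr hl (card_eq ▸ Finset.even_sum _ fun v _ => hm v)
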